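/- arXiv:math/0312132 — 3 statements merged into one kernel-verified Lean document; each statement's English description precedes it below -/
import Mathlib

section
/- As x → ∞, (Φ⁻¹(S_α(x)))² = 2α·log x − log log x − 2·log(K·α^(α/2)) − 2·log(2√π) + o(1). -/
open MeasureTheory Filter Set Asymptotics
open scoped Topology

noncomputable section

/-- The standard normal cumulative distribution function `Φ`. -/
def normCDF (y : ℝ) : ℝ := ∫ u in Iic y, Real.exp (-u ^ 2 / 2) / Real.sqrt (2 * Real.pi)

/-- The standard normal density. -/
def normPDF (u : ℝ) : ℝ := Real.exp (-u ^ 2 / 2) / Real.sqrt (2 * Real.pi)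

lemma normPDF_pos (u : ℝ) : 0 < normPDF u := by
  unfold normPDF
  positivity

lemma continuous_normPDF : Continuous normPDF := by
  unfold normPDF
  fun_prop

lemma normPDF_eq_gaussianPDFReal : normPDF = ProbabilityTheory.gaussianPDFReal 0 1 := by
  ext u
  simp [normPDF, ProbabilityTheory.gaussianPDFReal, div_eq_inv_mul]

lemma integrable_normPDF : Integrable normPDF := by
  rw [normPDF_eq_gaussianPDFReal]
  exact ProbabilityTheory.integrable_gaussianPDFReal 0 1

lemma integral_normPDF : ∫ u, normPDF u = 1 := by
  rw [normPDF_eq_gaussianPDFReal]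
  exact ProbabilityTheory.integral_gaussianPDFReal_eq_one 0 one_ne_zero

lemma hasDerivAt_normPDF (y : ℝ) : HasDerivAt normPDF (-y * normPDF y) y := by
  have h : HasDerivAt (fun u : ℝ => -u ^ 2 / 2) (-y) y := by
    refine (((hasDerivAt_pow 2 y).neg).div_const 2).congr_deriv ?_
    norm_num
    ring
  refine ((h.exp).div_const (Real.sqrt (2 * Real.pi))).congr_deriv ?_
  unfold normPDF
  ring

lemma hasDerivAt_normCDF (y : ℝ) : HasDerivAt normCDF (normPDF y) y := by
  have h : normCDF = fun z => normCDF 0 + ∫ u in (0 : ℝ)..z, normPDF u := by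
    ext z
    have := intervalIntegral.integral_Iic_sub_Iic (f := normPDF) (a := 0) (b := z)
      integrable_normPDF.integrableOn integrable_normPDF.integrableOn
    rw [← this]
    simp only [normCDF, normPDF]
    ring
  rw [h]
  exact (intervalIntegral.integral_hasDerivAt_right (continuous_normPDF.intervalIntegrable _ _)
    (continuous_normPDF.stronglyMeasurableAtFilter _ _) continuous_normPDF.continuousAt).const_add _

lemma strictMono_normCDF : StrictMono normCDF :=
  strictMono_of_hasDerivAt_pos hasDerivAt_normCDF normPDF_pos

lemma tendsto_normCDF_atTop : Tendsto normCDF atTop (𝓝 1) := by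
  have := (aecover_Iic (μ := volume) (l := atTop) tendsto_id).integral_tendsto_of_countably_generated
    integrable_normPDF
  rwa [integral_normPDF] at this

lemma normCDF_lt_one (y : ℝ) : normCDF y < 1 :=
  (strictMono_normCDF (lt_add_one y)).trans_le
    (strictMono_normCDF.monotone.ge_of_tendsto tendsto_normCDF_atTop _)

lemma tendsto_normPDF_atTop : Tendsto normPDF atTop (𝓝 0) := by
  have h : Tendsto (fun u : ℝ => u ^ 2 / 2) atTop atTop :=
    (tendsto_pow_atTop two_ne_zero).atTop_div_const two_pos
  have := (Real.tendsto_exp_neg_atTop_nhds_zero.comp h).div_const (Real.sqrt (2 * Real.pi))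
  rw [zero_div] at this
  refine this.congr fun u => ?_
  simp only [normPDF, Function.comp, neg_div]

/-- The asymptotics of Mills' ratio. -/
lemma tendsto_mills_ratio :
    Tendsto (fun y => (1 - normCDF y) / (normPDF y / y)) atTop (𝓝 1) := by
  refine HasDerivAt.lhopital_zero_atTop (f' := fun y => -normPDF y)
    (g' := fun y => -normPDF y * (1 + (y ^ 2)⁻¹)) ?_ ?_ ?_ ?_ ?_ ?_
  · exact .of_forall fun y => (hasDerivAt_normCDF y).const_sub 1
  · filter_upwards [eventually_gt_atTop 0] with y hy
    refine ((hasDerivAt_normPDF y).div (hasDerivAt_id y) hy.ne').congr_deriv ?_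
    simp only [id]
    field_simp
    ring
  · filter_upwards with y
    have := normPDF_pos y
    exact mul_ne_zero (neg_ne_zero.2 this.ne') (by positivity)
  · simpa using tendsto_normCDF_atTop.const_sub 1
  · simpa [div_eq_mul_inv] using tendsto_normPDF_atTop.mul tendsto_inv_atTop_zero
  · have h : Tendsto (fun y : ℝ => (1 + (y ^ 2)⁻¹)⁻¹) atTop (𝓝 1) := by
      have := (tendsto_inv_atTop_zero.comp
        (tendsto_pow_atTop (α := ℝ) two_ne_zero)).const_add 1 |>.inv₀ (by norm_num)
      simpa [Function.comp_def] using this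
    refine h.congr fun y => ?_
    have := (normPDF_pos y).ne'
    field_simp

lemma tendsto_log_of_tendsto_one {ι : Type*} {l : Filter ι} {f : ι → ℝ}
    (h : Tendsto f l (𝓝 1)) : Tendsto (fun i => Real.log (f i)) l (𝓝 0) := by
  simpa using h.log one_ne_zero

lemma tendsto_sq_add_log_normCDF :
    Tendsto (fun y => y ^ 2 + 2 * Real.log (1 - normCDF y) + 2 * Real.log y +
      Real.log (2 * Real.pi)) atTop (𝓝 0) := by
  have := (tendsto_log_of_tendsto_one tendsto_mills_ratio).const_mul 2
  rw [mul_zero] at this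
  refine this.congr' ?_
  filter_upwards [eventually_gt_atTop 0] with y hy
  have h1 : 1 - normCDF y ≠ 0 := (sub_pos.2 (normCDF_lt_one y)).ne'
  have h2 := (normPDF_pos y).ne'
  have h3 : Real.log (normPDF y) = -y ^ 2 / 2 - Real.log (2 * Real.pi) / 2 := by
    rw [normPDF, Real.log_div (Real.exp_ne_zero _) (by positivity), Real.log_exp,
      Real.log_sqrt (by positivity)]
  rw [Real.log_div h1 (div_ne_zero h2 hy.ne'), Real.log_div h2 hy.ne', h3]
  ring

lemma tendsto_neg_log_normCDF_div_sq :
    Tendsto (fun y => -2 * Real.log (1 - normCDF y) / y ^ 2) atTop (𝓝 1) := by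
  have hsq : Tendsto (fun y : ℝ => (y ^ 2)⁻¹) atTop (𝓝 0) :=
    tendsto_inv_atTop_zero.comp (tendsto_pow_atTop two_ne_zero)
  have hlog : Tendsto (fun y : ℝ => Real.log y / y ^ 2) atTop (𝓝 0) := by
    have := Real.isLittleO_pow_log_id_atTop (n := 1) |>.tendsto_div_nhds_zero
    have := this.mul tendsto_inv_atTop_zero
    rw [mul_zero] at this
    refine this.congr fun y => ?_
    simp only [pow_one, id]
    ring
  have := (((hlog.const_mul 2).const_add 1).add (hsq.const_mul (Real.log (2 * Real.pi)))).sub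
    (tendsto_sq_add_log_normCDF.mul hsq)
  simp only [mul_zero, add_zero, sub_zero] at this
  refine this.congr' ?_
  filter_upwards [eventually_gt_atTop 0] with y hy
  field_simp
  ring

/-- The asymptotics of the squared normal quantile in terms of the tail probability. -/
lemma tendsto_sq_add_log_add_log_log_normCDF :
    Tendsto (fun y => y ^ 2 + 2 * Real.log (1 - normCDF y) +
      Real.log (-2 * Real.log (1 - normCDF y)) + Real.log (2 * Real.pi)) atTop (𝓝 0) := by
  have := tendsto_sq_add_log_normCDF.add (tendsto_log_of_tendsto_one tendsto_neg_log_normCDF_div_sq)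
  rw [add_zero] at this
  refine this.congr' ?_
  filter_upwards [eventually_gt_atTop 0,
    tendsto_neg_log_normCDF_div_sq.eventually_ne one_ne_zero] with y hy hne
  have h : -2 * Real.log (1 - normCDF y) ≠ 0 := fun h => hne (by rw [h, zero_div])
  rw [Real.log_div h (by positivity), Real.log_pow]
  push_cast
  ring

lemma tendsto_atTop_of_tendsto_normCDF {ι : Type*} {l : Filter ι} {f : ι → ℝ}
    (h : Tendsto (fun i => normCDF (f i)) l (𝓝 1)) : Tendsto f l atTop := by
  refine tendsto_atTop.2 fun M => ?_
  filter_upwards [h.eventually_const_lt (normCDF_lt_one M)] with i hi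
  exact (strictMono_normCDF.lt_iff_lt.1 hi).le

/-- The logarithm of a power tail. -/
lemma tendsto_log_add_of_isEquivalent_div_rpow {α C : ℝ} (hC : 0 < C) {q : ℝ → ℝ}
    (hq : ∀ x, 0 < q x) (h : q ~[atTop] fun x => C / x ^ α) :
    Tendsto (fun x => Real.log (q x) + α * Real.log x - Real.log C) atTop (𝓝 0) := by
  have hne : ∀ᶠ x : ℝ in atTop, C / x ^ α ≠ 0 := by
    filter_upwards [eventually_gt_atTop 0] with x hx
    positivity
  refine (tendsto_log_of_tendsto_one ((isEquivalent_iff_tendsto_one hne).1 h)).congr' ?_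
  filter_upwards [eventually_gt_atTop 0] with x hx
  rw [Pi.div_apply, Real.log_div (hq x).ne' (by positivity),
    Real.log_div hC.ne' (by positivity), Real.log_rpow hx]
  ring

lemma tendsto_log_neg_log_sub {α c : ℝ} (hα : 0 < α) {f : ℝ → ℝ}
    (h : Tendsto (fun x => f x + α * Real.log x - c) atTop (𝓝 0)) :
    Tendsto (fun x => Real.log (-2 * f x) - Real.log (2 * α) - Real.log (Real.log x))
      atTop (𝓝 0) := by
  have hinv : Tendsto (fun x => (Real.log x)⁻¹) atTop (𝓝 0) :=
    tendsto_inv_atTop_zero.comp Real.tendsto_log_atTop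
  have hratio : Tendsto (fun x => -2 * f x / (2 * α * Real.log x)) atTop (𝓝 1) := by
    have := (((h.add_const c).mul hinv).div_const α).const_sub 1
    simp only [mul_zero, zero_div, sub_zero] at this
    refine this.congr' ?_
    filter_upwards [eventually_gt_atTop 1] with x hx
    have := Real.log_pos hx
    field_simp
    ring
  refine (tendsto_log_of_tendsto_one hratio).congr' ?_
  filter_upwards [eventually_gt_atTop 1, hratio.eventually_ne one_ne_zero] with x hx hne
  have hlog := Real.log_pos hx
  have h0 : -2 * f x ≠ 0 := fun h => hne (by rw [h, zero_div])
  rw [Real.log_div h0 (by positivity), Real.log_mul (by positivity) hlog.ne']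
  ring

/-- **Lemma A.1.5 (first part).** As `x → ∞`,
`(Φ⁻¹(S_α(x)))² = 2α log x − log log x − 2 log(K α^(α/2)) − 2 log(2√π) + o(1)`. -/
theorem sq_normCDF_inv_comp_cdf_asymptotic
    (α K : ℝ) (hα : 0 < α) (hK : 0 < K)
    (sα Sα : ℝ → ℝ)
    (hs_cont : Continuous sα) (hs_pos : ∀ x, 0 < sα x)
    (hSα : ∀ x, Sα x = ∫ u in Iic x, sα u)
    (hrange : ∀ x, Sα x ∈ Ioo (0 : ℝ) 1)
    (htail_left : (fun x => Sα (-x)) ~[atTop] fun x => K * α ^ ((α - 1) / 2) / x ^ α)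
    (htail_right : (fun x => 1 - Sα x) ~[atTop] fun x => K * α ^ ((α - 1) / 2) / x ^ α)
    (Φinv : ℝ → ℝ) (hΦinv : ∀ p ∈ Ioo (0 : ℝ) 1, normCDF (Φinv p) = p) :
    Tendsto
      (fun x => (Φinv (Sα x)) ^ 2 -
        (2 * α * Real.log x - Real.log (Real.log x) -
          2 * Real.log (K * α ^ (α / 2)) - 2 * Real.log (2 * Real.sqrt Real.pi)))
      atTop (𝓝 0) := by
  set C := K * α ^ ((α - 1) / 2) with hC
  have hCpos : 0 < C := by positivity
  have hzero : Tendsto (fun x : ℝ => C / x ^ α) atTop (𝓝 0) :=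
    (tendsto_rpow_atTop hα).const_div_atTop C
  have hS : Tendsto Sα atTop (𝓝 1) := by
    simpa using (htail_right.symm.tendsto_nhds hzero).const_sub 1
  have hinv (x : ℝ) : normCDF (Φinv (Sα x)) = Sα x := hΦinv _ (hrange x)
  have htop : Tendsto (fun x => Φinv (Sα x)) atTop atTop :=
    tendsto_atTop_of_tendsto_normCDF (by simpa only [hinv] using hS)
  have hlog := tendsto_log_add_of_isEquivalent_div_rpow hCpos
    (fun x => sub_pos.2 (hrange x).2) htail_right
  have hloglog := tendsto_log_neg_log_sub hα hlog
  have := ((tendsto_sq_add_log_add_log_log_normCDF.comp htop).sub (hlog.const_mul 2)).sub hloglog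
  simp only [mul_zero, sub_zero] at this
  refine this.congr fun x => ?_
  have hpi : Real.log (2 * Real.sqrt Real.pi) = Real.log 2 + Real.log Real.pi / 2 := by
    rw [Real.log_mul (by positivity) (by positivity), Real.log_sqrt (by positivity)]
  simp only [Function.comp, hinv]
  rw [hpi, hC, Real.log_mul hK.ne' (by positivity), Real.log_mul hK.ne' (by positivity),
    Real.log_rpow hα, Real.log_rpow hα, Real.log_mul two_ne_zero Real.pi_ne_zero,
    Real.log_mul two_ne_zero hα.ne']
  ring

end
end

section
/- As x → ∞, Φ⁻¹(S_α(x)) = √(2α·log x) + o(1). -/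
open MeasureTheory Filter Set Asymptotics
open scoped Topology

noncomputable section

open ProbabilityTheory in
lemma exp_neg_sq_div_two_div_sqrt_eq_gaussianPDFReal :
    (fun u : ℝ => Real.exp (-u ^ 2 / 2) / Real.sqrt (2 * Real.pi)) = gaussianPDFReal 0 1 := by
  funext u
  simp [gaussianPDFReal, div_eq_inv_mul]

open ProbabilityTheory in
lemma one_sub_normCDF (y : ℝ) : 1 - normCDF y = ∫ u in Ioi y, gaussianPDFReal 0 1 u := by
  have h := integral_add_compl (measurableSet_Iic (a := y)) (integrable_gaussianPDFReal 0 1)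
  rw [integral_gaussianPDFReal_eq_one 0 one_ne_zero, compl_Iic] at h
  rw [normCDF, exp_neg_sq_div_two_div_sqrt_eq_gaussianPDFReal]
  linarith

open ProbabilityTheory in
lemma monotone_normCDF : Monotone normCDF := by
  intro a b hab
  rw [normCDF, normCDF, exp_neg_sq_div_two_div_sqrt_eq_gaussianPDFReal]
  exact setIntegral_mono_set (integrable_gaussianPDFReal 0 1).integrableOn
    (ae_of_all _ (gaussianPDFReal_nonneg 0 1)) (Iic_subset_Iic.2 hab).eventuallyLE

open ProbabilityTheory in
lemma one_sub_normCDF_le_exp {y : ℝ} (hy : 0 ≤ y) :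
    1 - normCDF y ≤ Real.exp (-y ^ 2 / 2) := by
  have hint : Integrable fun u => Real.exp (-y ^ 2 / 2) * gaussianPDFReal 0 1 (u - y) :=
    ((integrable_gaussianPDFReal 0 1).comp_sub_right y).const_mul _
  rw [one_sub_normCDF]
  calc ∫ u in Ioi y, gaussianPDFReal 0 1 u
      ≤ ∫ u in Ioi y, Real.exp (-y ^ 2 / 2) * gaussianPDFReal 0 1 (u - y) := by
        refine setIntegral_mono_on (integrable_gaussianPDFReal 0 1).integrableOn
          hint.integrableOn measurableSet_Ioi fun u (hu : y < u) => ?_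
        rw [← exp_neg_sq_div_two_div_sqrt_eq_gaussianPDFReal]
        simp only [← mul_div_assoc, ← Real.exp_add]
        gcongr
        nlinarith
    _ ≤ ∫ u, Real.exp (-y ^ 2 / 2) * gaussianPDFReal 0 1 (u - y) :=
        setIntegral_le_integral hint
          (ae_of_all _ fun u => mul_nonneg (Real.exp_pos _).le (gaussianPDFReal_nonneg 0 1 _))
    _ = Real.exp (-y ^ 2 / 2) := by
        rw [integral_const_mul, integral_sub_right_eq_self (gaussianPDFReal 0 1),
          integral_gaussianPDFReal_eq_one 0 one_ne_zero, mul_one]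

open ProbabilityTheory in
lemma mul_exp_le_one_sub_normCDF {y δ : ℝ} (hy : 0 ≤ y) (hδ : 0 ≤ δ) :
    δ * (Real.exp (-(y + δ) ^ 2 / 2) / Real.sqrt (2 * Real.pi)) ≤ 1 - normCDF y := by
  rw [one_sub_normCDF]
  calc δ * (Real.exp (-(y + δ) ^ 2 / 2) / Real.sqrt (2 * Real.pi))
      = ∫ _ in Ioc y (y + δ), Real.exp (-(y + δ) ^ 2 / 2) / Real.sqrt (2 * Real.pi) := by
        simp [hδ]
    _ ≤ ∫ u in Ioc y (y + δ), gaussianPDFReal 0 1 u := by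
        refine setIntegral_mono_on (integrableOn_const (by simp))
          (integrable_gaussianPDFReal 0 1).integrableOn measurableSet_Ioc fun u hu => ?_
        rw [← exp_neg_sq_div_two_div_sqrt_eq_gaussianPDFReal]
        have hu0 : 0 ≤ u := hy.trans hu.1.le
        have := hu.2
        dsimp only
        gcongr
    _ ≤ ∫ u in Ioi y, gaussianPDFReal 0 1 u :=
        setIntegral_mono_set (integrable_gaussianPDFReal 0 1).integrableOn
          (ae_of_all _ (gaussianPDFReal_nonneg 0 1)) Ioc_subset_Ioi_self.eventuallyLE

/-- The upper tail of the normal distribution at `t + ε` is negligible against `exp (-t ^ 2 / 2)`. -/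
lemma eventually_one_sub_normCDF_add_lt {c ε : ℝ} (hc : 0 < c) (hε : 0 < ε) :
    ∀ᶠ t in atTop, 1 - normCDF (t + ε) < c * Real.exp (-t ^ 2 / 2) := by
  have h : Tendsto (fun t : ℝ => Real.exp (-(ε * t))) atTop (𝓝 0) :=
    Real.tendsto_exp_neg_atTop_nhds_zero.comp (tendsto_id.const_mul_atTop hε)
  filter_upwards [h.eventually_lt_const hc, eventually_ge_atTop 0] with t ht ht0
  calc 1 - normCDF (t + ε) ≤ Real.exp (-(t + ε) ^ 2 / 2) := one_sub_normCDF_le_exp (by positivity)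
    _ ≤ Real.exp (-(ε * t)) * Real.exp (-t ^ 2 / 2) := by
        rw [← Real.exp_add]
        gcongr
        nlinarith
    _ < c * Real.exp (-t ^ 2 / 2) := by gcongr

/-- The upper tail of the normal distribution at `t - ε` dominates `exp (-t ^ 2 / 2)`. -/
lemma eventually_lt_one_sub_normCDF_sub (c : ℝ) {ε : ℝ} (hε : 0 < ε) :
    ∀ᶠ t in atTop, c * Real.exp (-t ^ 2 / 2) < 1 - normCDF (t - ε) := by
  have hb : 0 < ε / 2 / Real.sqrt (2 * Real.pi) * Real.exp (-ε ^ 2 / 8) := by positivity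
  have h : Tendsto (fun t : ℝ =>
      ε / 2 / Real.sqrt (2 * Real.pi) * Real.exp (-ε ^ 2 / 8) * Real.exp (ε / 2 * t))
      atTop atTop :=
    (Real.tendsto_exp_atTop.comp (tendsto_id.const_mul_atTop (half_pos hε))).const_mul_atTop hb
  filter_upwards [h.eventually_gt_atTop c, eventually_ge_atTop ε] with t ht htε
  calc c * Real.exp (-t ^ 2 / 2)
      < ε / 2 / Real.sqrt (2 * Real.pi) * Real.exp (-ε ^ 2 / 8) * Real.exp (ε / 2 * t) *
          Real.exp (-t ^ 2 / 2) := by gcongr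
    _ = ε / 2 * (Real.exp (-(t - ε + ε / 2) ^ 2 / 2) / Real.sqrt (2 * Real.pi)) := by
        have : -(t - ε + ε / 2) ^ 2 / 2 = -ε ^ 2 / 8 + ε / 2 * t + -t ^ 2 / 2 := by ring
        rw [this, Real.exp_add, Real.exp_add]
        ring
    _ ≤ 1 - normCDF (t - ε) :=
        mul_exp_le_one_sub_normCDF (sub_nonneg.2 htε) (half_pos hε).le

/-- **Lemma A.1.5 (second part).** As `x → ∞`, `Φ⁻¹(S_α(x)) = √(2α log x) + o(1)`. -/
theorem normCDF_inv_comp_cdf_asymptotic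
    (α K : ℝ) (hα : 0 < α) (hK : 0 < K)
    (sα Sα : ℝ → ℝ)
    (hs_cont : Continuous sα) (hs_pos : ∀ x, 0 < sα x)
    (hSα : ∀ x, Sα x = ∫ u in Iic x, sα u)
    (hrange : ∀ x, Sα x ∈ Ioo (0 : ℝ) 1)
    (htail_left : (fun x => Sα (-x)) ~[atTop] fun x => K * α ^ ((α - 1) / 2) / x ^ α)
    (htail_right : (fun x => 1 - Sα x) ~[atTop] fun x => K * α ^ ((α - 1) / 2) / x ^ α)
    (Φinv : ℝ → ℝ) (hΦinv : ∀ p ∈ Ioo (0 : ℝ) 1, normCDF (Φinv p) = p) :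
    Tendsto (fun x => Φinv (Sα x) - Real.sqrt (2 * α * Real.log x)) atTop (𝓝 0) := by
  have hA : 0 < K * α ^ ((α - 1) / 2) := by positivity
  set A := K * α ^ ((α - 1) / 2)
  have hne : ∀ᶠ x : ℝ in atTop, A / x ^ α ≠ 0 := by
    filter_upwards [eventually_gt_atTop 0] with x hx
    positivity
  have hratio := (isEquivalent_iff_tendsto_one hne).1 htail_right
  have ht : Tendsto (fun x => Real.sqrt (2 * α * Real.log x)) atTop atTop :=
    Real.tendsto_sqrt_atTop.comp (Real.tendsto_log_atTop.const_mul_atTop (by positivity))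
  rw [Metric.tendsto_nhds]
  intro ε hε
  filter_upwards [hratio.eventually_lt_const one_lt_two,
    hratio.eventually_const_lt one_half_lt_one, eventually_gt_atTop 1,
    ht.eventually (eventually_one_sub_normCDF_add_lt (half_pos hA) hε),
    ht.eventually (eventually_lt_one_sub_normCDF_sub (2 * A) hε)] with x hlt hgt hx hadd hsub
  have hx0 : 0 < x := by positivity
  have hexp : Real.exp (-Real.sqrt (2 * α * Real.log x) ^ 2 / 2) = (x ^ α)⁻¹ := by
    have := Real.log_pos hx
    rw [Real.sq_sqrt (by positivity), Real.rpow_def_of_pos hx0, ← Real.exp_neg]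
    ring_nf
  have hpos : 0 < A / x ^ α := by positivity
  simp only [Pi.div_apply] at hlt hgt
  rw [div_lt_iff₀ hpos] at hlt
  rw [lt_div_iff₀ hpos] at hgt
  rw [hexp] at hadd hsub
  have hΦ := hΦinv _ (hrange x)
  rw [Real.dist_eq, sub_zero, abs_lt, neg_lt_sub_iff_lt_add, sub_lt_iff_lt_add']
  have hup : A / 2 * (x ^ α)⁻¹ = 1 / 2 * (A / x ^ α) := by ring
  have hlo : 2 * A * (x ^ α)⁻¹ = 2 * (A / x ^ α) := by ring
  constructor
  · by_contra! hle
    have := monotone_normCDF (show Φinv (Sα x) ≤ Real.sqrt (2 * α * Real.log x) - ε by linarith)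
    linarith
  · by_contra! hle
    have := monotone_normCDF hle
    linarith

end
end

section
/- Under the nondegeneracy assumption (8.2.8), there exists ε₀ > 0 such that for every I ∈ J(C), every m ∈ M_I, and every i ∈ I, one has |m_i| ≥ ε₀, where m_i = ⟨m, e_i⟩. -/
open MeasureTheory Filter Set Asymptotics
open scoped Topology Classical

noncomputable section

/-- The quadratic form `⟨Cx, x⟩`. -/
def quadForm {d : ℕ} (C : Matrix (Fin d) (Fin d) ℝ) (x : Fin d → ℝ) : ℝ :=
  ∑ i, (∑ j, C i j * x j) * x i

/-- `x` lies in `V_I = span{e_i : i ∈ I}`. -/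
def suppIn {d : ℕ} (I : Finset (Fin d)) (x : Fin d → ℝ) : Prop :=
  ∀ i ∉ I, x i = 0

/-- `N(C)`, the minimal cardinality of a set `I` such that `⟨Cu,u⟩ > 0` for some `u ∈ V_I`. -/
def Ncal {d : ℕ} (C : Matrix (Fin d) (Fin d) ℝ) : ℕ :=
  sInf {n | ∃ I : Finset (Fin d), I.card = n ∧ ∃ u : Fin d → ℝ, suppIn I u ∧ 0 < quadForm C u}

/-- `J(C)`, the sets `I` of minimal cardinality `N(C)` carrying a vector with `⟨Cu,u⟩ > 0`. -/
def Jcal {d : ℕ} (C : Matrix (Fin d) (Fin d) ℝ) : Set (Finset (Fin d)) :=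
  {I | I.card = Ncal C ∧ ∃ u : Fin d → ℝ, suppIn I u ∧ 0 < quadForm C u}

/-- `M_I = {m ∈ V_I : ⟨Cm,m⟩ = 1}`. -/
def Mman {d : ℕ} (C : Matrix (Fin d) (Fin d) ℝ) (I : Finset (Fin d)) : Set (Fin d → ℝ) :=
  {m | suppIn I m ∧ quadForm C m = 1}

/-- The nondegeneracy assumption (8.2.8). -/
def Nondeg {d : ℕ} (C : Matrix (Fin d) (Fin d) ℝ) : Prop :=
  ∀ I : Finset (Fin d), I.card < Ncal C →
    ∀ u : Fin d → ℝ, suppIn I u → u ≠ 0 → quadForm C u < 0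

theorem continuous_quadForm {d : ℕ} (C : Matrix (Fin d) (Fin d) ℝ) : Continuous (quadForm C) := by
  unfold quadForm
  fun_prop

theorem quadForm_smul {d : ℕ} (C : Matrix (Fin d) (Fin d) ℝ) (a : ℝ) (x : Fin d → ℝ) :
    quadForm C (a • x) = a ^ 2 * quadForm C x := by
  simp only [quadForm, Pi.smul_apply, smul_eq_mul, Finset.mul_sum, Finset.sum_mul]
  refine Finset.sum_congr rfl fun i _ => Finset.sum_congr rfl fun j _ => ?_
  ring

theorem isClosed_setOf_suppIn {d : ℕ} (I : Finset (Fin d)) :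
    IsClosed {x : Fin d → ℝ | suppIn I x} := by
  simp only [suppIn, Set.ofPred_forall]
  exact isClosed_iInter fun i => isClosed_iInter fun _ =>
    isClosed_eq (continuous_apply i) continuous_const

/-- If `⟨Cu,u⟩ < 0` for all nonzero `u ∈ V_I` with `u_i = 0`, then the form is dominated on `V_I`
by a multiple of the square of the `i`-th coordinate. -/
theorem exists_quadForm_lt_mul_sq {d : ℕ} (C : Matrix (Fin d) (Fin d) ℝ) (I : Finset (Fin d))
    (i : Fin d) (hneg : ∀ u, suppIn (I.erase i) u → u ≠ 0 → quadForm C u < 0) :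
    ∃ n : ℕ, ∀ x, suppIn I x → x ≠ 0 → quadForm C x < n * x i ^ 2 := by
  have hK : IsCompact (Metric.sphere (0 : Fin d → ℝ) 1 ∩ {x | suppIn I x}) :=
    (isCompact_sphere _ _).inter_right (isClosed_setOf_suppIn I)
  obtain ⟨n, hn⟩ := hK.elim_directed_cover
    (fun n : ℕ => {x : Fin d → ℝ | quadForm C x < n * x i ^ 2})
    (fun n => isOpen_lt (continuous_quadForm C) (by fun_prop))
    (by
      rintro x ⟨hx, hxI⟩
      have hx0 : x ≠ 0 := ne_zero_of_mem_unit_sphere (⟨x, hx⟩ : Metric.sphere (0 : Fin d → ℝ) 1)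
      rw [mem_iUnion]
      by_cases hxi : x i = 0
      · refine ⟨0, ?_⟩
        have := hneg x (fun j hj => ?_) hx0
        · simpa using this
        · by_cases hji : j = i
          · rwa [hji]
          · exact hxI j fun h => hj (Finset.mem_erase.2 ⟨hji, h⟩)
      · obtain ⟨n, hn⟩ := exists_nat_gt (quadForm C x / x i ^ 2)
        exact ⟨n, (div_lt_iff₀ (by positivity)).1 hn⟩)
    (Monotone.directed_le <| by
      intro a b hab x (hx : quadForm C x < a * x i ^ 2)
      have hle : (a : ℝ) * x i ^ 2 ≤ b * x i ^ 2 := by gcongr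
      exact hx.trans_le hle)
  refine ⟨n, fun x hxI hx0 => ?_⟩
  have hpos : 0 < ‖x‖⁻¹ := inv_pos.2 (norm_pos_iff.2 hx0)
  have hmem : quadForm C (‖x‖⁻¹ • x) < n * (‖x‖⁻¹ • x) i ^ 2 := by
    refine hn ⟨?_, fun j hj => ?_⟩
    · simp [norm_smul, hx0]
    · simp [hxI j hj]
  rw [quadForm_smul, Pi.smul_apply, smul_eq_mul, mul_pow, mul_left_comm] at hmem
  exact lt_of_mul_lt_mul_left hmem (by positivity)

/-- **Lemma 8.2.11.** Under the nondegeneracy assumption (8.2.8), there exists `ε₀ > 0` such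
that for all `I ∈ J(C)`, all `m ∈ M_I`, and all `i ∈ I`, the inequality `|m_i| ≥ ε₀` holds. -/
theorem Mman_coords_bounded_below
    {d : ℕ} (C : Matrix (Fin d) (Fin d) ℝ)
    (hpos : ∃ u : Fin d → ℝ, 0 < quadForm C u)
    (hnondeg : Nondeg C) :
    ∃ ε₀ : ℝ, 0 < ε₀ ∧ ∀ I ∈ Jcal C, ∀ m ∈ Mman C I, ∀ i ∈ I, ε₀ ≤ |m i| := by
  have key : ∀ I : Finset (Fin d), ∀ i : Fin d, ∀ᶠ n : ℕ in atTop,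
      I ∈ Jcal C → i ∈ I → ∀ m ∈ Mman C I, 1 < n * m i ^ 2 := by
    intro I i
    by_cases h : I ∈ Jcal C ∧ i ∈ I
    · obtain ⟨n, hn⟩ := exists_quadForm_lt_mul_sq C I i
        (hnondeg _ (h.1.1 ▸ Finset.card_erase_lt_of_mem h.2))
      filter_upwards [eventually_ge_atTop n] with k hk _ _ m hm
      have hm0 : m ≠ 0 := by
        rintro rfl
        simpa [quadForm] using hm.2
      calc 1 = quadForm C m := hm.2.symm
        _ < n * m i ^ 2 := hn m hm.1 hm0
        _ ≤ k * m i ^ 2 := by gcongr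
    · exact Eventually.of_forall fun n hI hi => absurd ⟨hI, hi⟩ h
  obtain ⟨n, hn⟩ := (eventually_all.2 fun I => eventually_all.2 (key I)).exists
  refine ⟨1 / (n + 1), by positivity, fun I hI m hm i hi => ?_⟩
  by_contra! hlt
  have hm := hn I i hI hi m hm
  rw [lt_div_iff₀ (by positivity)] at hlt
  rw [← sq_abs] at hm
  have hn0 : (0 : ℝ) ≤ n := n.cast_nonneg
  nlinarith [abs_nonneg (m i), mul_nonneg hn0 (abs_nonneg (m i))]

end
end
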